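/- arXiv:2202.03024 — 3 statements merged into one kernel-verified Lean document; each statement's English description precedes it below -/
import Mathlib

section
/- Let n ≥ 2, q ≥ 2, m = n−1, R ∈ {1,…,m}, and r = m mod R. The maximum of H^In_{1-Del}(y) over all y ∈ Σ_{q,R}^m equals log₂(nq) − (r/(nq))·(⌈m/R⌉+1) log₂(⌈m/R⌉+1) − ((R−r)/(nq))·(⌊m/R⌋+1) log₂(⌊m/R⌋+1), and this maximum is attained exactly by the balanced words of Σ_{q,R}^m. -/
open scoped Classical

noncomputable section

/-- The embedding number `ω_y(x)`: the number of distinct occurrences of `y`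
as a subsequence of `x` (i.e. the number of index tuples realizing `y` in `x`). -/
def emb {q : ℕ} (y x : List (Fin q)) : ℕ := x.sublists.count y

/-- The run length profile of a word: the list of lengths of its maximal
blocks of identical consecutive symbols, in order. -/
def runLengths {α : Type*} [DecidableEq α] : List α → List ℕ
  | [] => []
  | [_] => [1]
  | a :: b :: l =>
    if a = b then
      match runLengths (b :: l) with
      | [] => [1]
      | r :: rs => (r + 1) :: rs
    else 1 :: runLengths (b :: l)

/-- Input entropy `H^In_{k-Del}(y)` of the `k`-deletion channel over `Σ_q`
under uniform transmission, for a channel output `y ∈ Σ_q^{n-k}`: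
`-∑_{x ∈ I_k(y)} p(x) log₂ p(x)` with `p(x) = ω_y(x) / (C(n,k) q^k)`. -/
def Hdel (q n k : ℕ) (y : Fin (n - k) → Fin q) : ℝ :=
  - ∑ x ∈ Finset.univ.filter
      (fun x : Fin n → Fin q => (List.ofFn y).Sublist (List.ofFn x)),
      ((emb (List.ofFn y) (List.ofFn x) : ℝ) / ((n.choose k : ℝ) * (q : ℝ) ^ k)) *
        Real.logb 2 ((emb (List.ofFn y) (List.ofFn x) : ℝ) / ((n.choose k : ℝ) * (q : ℝ) ^ k))

/-- Input entropy `H^In_{k-Ins}(y)` of the `k`-insertion channel over `Σ_q`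
under uniform transmission, for a channel output `y ∈ Σ_q^{n+k}`:
`-∑_{x ∈ D_k(y)} p(x) log₂ p(x)` with `p(x) = ω_x(y) / C(n+k,k)`. -/
def Hins (q n k : ℕ) (y : Fin (n + k) → Fin q) : ℝ :=
  - ∑ x ∈ Finset.univ.filter
      (fun x : Fin n → Fin q => (List.ofFn x).Sublist (List.ofFn y)),
      ((emb (List.ofFn x) (List.ofFn y) : ℝ) / ((n + k).choose k : ℝ)) *
        Real.logb 2 ((emb (List.ofFn x) (List.ofFn y) : ℝ) / ((n + k).choose k : ℝ))

/-- A run length profile `rl` of a word of length `m` with `R` runs is balanced if it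
consists of `m mod R` runs of length `⌈m/R⌉` and `R - (m mod R)` runs of length `⌊m/R⌋`. -/
def isBalanced (m R : ℕ) (rl : List ℕ) : Prop :=
  rl.Perm (List.replicate (m % R) ((m + R - 1) / R) ++ List.replicate (R - m % R) (m / R))

/-- A run length profile `rl` of a word of length `m` with `R` runs is skewed if it
consists of `R - 1` runs of length `1` and a single run of length `m - (R-1)`. -/
def isSkewed (m R : ℕ) (rl : List ℕ) : Prop :=
  rl.Perm ((m - (R - 1)) :: List.replicate (R - 1) 1)

/-- `fIdx rl i` is the smallest (1-based) index `j ∈ [i+1, R]` with `r_j > 1`;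
it is `R` if no such index exists, and `fIdx rl R = R`. -/
def fIdx (rl : List ℕ) (i : ℕ) : ℕ :=
  if i = rl.length then rl.length
  else if {j | i + 1 ≤ j ∧ j ≤ rl.length ∧ 1 < rl.getD (j - 1) 0}.Nonempty
    then sInf {j | i + 1 ≤ j ∧ j ≤ rl.length ∧ 1 < rl.getD (j - 1) 0}
    else rl.length

/-- `bIdx rl i` is the largest (1-based) index `j ∈ [1, i]` with `r_j > 1`;
it is `1` if no such index exists, and `bIdx rl 0 = 1`. -/
def bIdx (rl : List ℕ) (i : ℕ) : ℕ :=
  if i = 0 then 1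
  else if {j | 1 ≤ j ∧ j ≤ i ∧ 1 < rl.getD (j - 1) 0}.Nonempty
    then sSup {j | 1 ≤ j ∧ j ≤ i ∧ 1 < rl.getD (j - 1) 0}
    else 1

lemma emb_nil {q : ℕ} (x : List (Fin q)) : emb [] x = 1 := by
  unfold emb
  rw [(List.sublists_perm_sublists' x).count_eq]
  induction x with
  | nil => simp
  | cons a x ih =>
    rw [List.sublists'_cons, List.count_append, ih, List.count_eq_zero.2]
    simp

lemma emb_cons_nil {q : ℕ} (b : Fin q) (y : List (Fin q)) : emb (b :: y) [] = 0 := by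
  simp [emb]

lemma emb_cons_cons {q : ℕ} (a b : Fin q) (y x : List (Fin q)) :
    emb (b :: y) (a :: x) = emb (b :: y) x + if a = b then emb y x else 0 := by
  unfold emb
  rw [(List.sublists_perm_sublists' (a :: x)).count_eq, (List.sublists_perm_sublists' x).count_eq,
    (List.sublists_perm_sublists' x).count_eq, List.sublists'_cons, List.count_append]
  congr 1
  split_ifs with h
  · subst h
    exact List.count_map_of_injective _ _ (List.cons_injective) _
  · rw [List.count_eq_zero]
    simp [h]

lemma emb_eq_zero {q : ℕ} {y x : List (Fin q)} (h : ¬ y.Sublist x) : emb y x = 0 := by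
  unfold emb
  rw [List.count_eq_zero]
  simpa using h

lemma emb_eq_ite {q : ℕ} (y x : List (Fin q)) (h : x.length = y.length) :
    emb y x = if x = y then 1 else 0 := by
  induction x generalizing y with
  | nil =>
    obtain rfl : y = [] := by simpa using h.symm
    simp [emb_nil]
  | cons a x ih =>
    cases y with
    | nil => simp at h
    | cons b y =>
      have h' : x.length = y.length := by simpa using h
      rw [emb_cons_cons, ih y h', emb_eq_zero (fun hs => by have := hs.length_le; simp at this; omega)]
      by_cases hab : a = b <;> simp [hab]

/-- Summing a function of the embedding number over all one-symbol insertions, recursively in the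
output word. -/
lemma sum_emb_cons {q m : ℕ} (g : ℕ → ℝ) (hg : g 0 = 0) (b : Fin q) (y : List (Fin q))
    (hy : y.length = m) :
    ∑ x : Fin (m + 2) → Fin q, g (emb (b :: y) (List.ofFn x)) =
      ∑ x : Fin (m + 1) → Fin q, g (emb y (List.ofFn x)) + ((q : ℝ) - 1) * g 1 +
        (g (emb y (b :: y) + 1) - g (emb y (b :: y))) := by
  subst hy
  have hofn : List.ofFn (b :: y).get = b :: y := List.ofFn_get _
  have heq : ∀ x : Fin (y.length + 1) → Fin q, List.ofFn x = b :: y ↔ x = (b :: y).get := by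
    intro x
    constructor
    · intro h
      exact List.ofFn_injective (h.trans hofn.symm)
    · rintro rfl
      exact hofn
  have hcons : ∀ (a : Fin q) (x : Fin (y.length + 1) → Fin q),
      g (emb (b :: y) (List.ofFn (Fin.cons a x : Fin (y.length + 2) → Fin q))) =
        (if a = b then g (emb y (List.ofFn x)) else 0) +
        (if x = (b :: y).get then
          (if a = b then g (emb y (b :: y) + 1) - g (emb y (b :: y)) else g 1) else 0) := by
    intro a x
    rw [List.ofFn_cons, emb_cons_cons, emb_eq_ite _ _ (by simp)]
    by_cases hx : x = (b :: y).get
    · rw [if_pos ((heq x).2 hx), (heq x).2 hx, if_pos hx]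
      split_ifs
      · rw [add_comm 1]; ring
      · simp
    · rw [if_neg (fun h => hx ((heq x).1 h)), if_neg hx]
      split_ifs <;> simp [hg]
  rw [← (Fin.consEquiv (fun _ : Fin (y.length + 2) => Fin q)).sum_comp, Fintype.sum_prod_type]
  have : ∀ (a : Fin q), ∑ x : Fin (y.length + 1) → Fin q,
      g (emb (b :: y) (List.ofFn ((Fin.consEquiv (fun _ : Fin (y.length + 2) => Fin q)) (a, x)))) =
      g 1 + if a = b then (∑ x : Fin (y.length + 1) → Fin q, g (emb y (List.ofFn x)) +
        (g (emb y (b :: y) + 1) - g (emb y (b :: y))) - g 1) else 0 := by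
    intro a
    refine (Finset.sum_congr rfl fun x _ => hcons a x).trans ?_
    rw [Finset.sum_add_distrib, Finset.sum_ite_eq' Finset.univ, if_pos (Finset.mem_univ _)]
    split_ifs
    · ring
    · simp
  rw [Finset.sum_congr rfl fun a _ => this a, Finset.sum_add_distrib,
    Finset.sum_ite_eq' Finset.univ, if_pos (Finset.mem_univ _)]
  simp
  ring

lemma sum_emb_nil {q : ℕ} (g : ℕ → ℝ) :
    ∑ x : Fin 1 → Fin q, g (emb [] (List.ofFn x)) = q * g 1 := by
  simp [emb_nil]

lemma sum_emb {q : ℕ} (y : List (Fin q)) {m : ℕ} (hy : y.length = m) :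
    ∑ x : Fin (m + 1) → Fin q, (emb y (List.ofFn x) : ℝ) = ((m : ℝ) + 1) * q := by
  induction y generalizing m with
  | nil =>
    subst hy
    simpa using sum_emb_nil (q := q) (fun n => (n : ℝ))
  | cons b y ih =>
    subst hy
    have := sum_emb_cons (fun n => (n : ℝ)) (by simp) b y rfl
    simp only [List.length_cons]
    rw [this, ih rfl]
    push_cast
    ring

lemma runLengths_cons_self {α : Type*} [DecidableEq α] (b : α) (y : List α) :
    ∃ k rs, runLengths (b :: y) = (k + 1) :: rs ∧
      runLengths (b :: b :: y) = (k + 2) :: rs := by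
  have h : ∃ k rs, runLengths (b :: y) = (k + 1) :: rs := by
    cases y with
    | nil => exact ⟨0, [], rfl⟩
    | cons c y =>
      rw [runLengths]
      split_ifs
      · split
        · exact ⟨0, [], rfl⟩
        · exact ⟨_, _, rfl⟩
      · exact ⟨0, _, rfl⟩
  obtain ⟨k, rs, h⟩ := h
  refine ⟨k, rs, h, ?_⟩
  rw [runLengths, if_pos rfl, h]

lemma emb_insert_head {q : ℕ} (b : Fin q) (y : List (Fin q)) :
    ∃ k rs, runLengths (b :: y) = k :: rs ∧ emb y (b :: y) = k := by
  induction y with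
  | nil => exact ⟨1, [], rfl, emb_nil _⟩
  | cons c y ih =>
    rw [emb_cons_cons, emb_eq_ite _ _ rfl, if_pos rfl]
    by_cases h : b = c
    · subst h
      obtain ⟨k, rs, h1, h2⟩ := runLengths_cons_self b y
      obtain ⟨k', rs', h1', h2'⟩ := ih
      rw [h1] at h1'
      refine ⟨_, _, h2, ?_⟩
      rw [h2', if_pos rfl, ← (List.cons.inj h1').1]
      ring
    · exact ⟨1, runLengths (c :: y), by rw [runLengths, if_neg h], by rw [if_neg h]⟩

lemma runLengths_cons_of_ne {α : Type*} [DecidableEq α] (b : α) (y : List α)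
    (h : y.head? ≠ some b) : runLengths (b :: y) = 1 :: runLengths y := by
  cases y with
  | nil => rfl
  | cons c y =>
    rw [runLengths, if_neg]
    rintro rfl
    simp at h

lemma sum_emb_eq_sum_runLengths {q : ℕ} (g : ℕ → ℝ) (h0 : g 0 = 0) (h1 : g 1 = 0)
    (y : List (Fin q)) {m : ℕ} (hy : y.length = m) :
    ∑ x : Fin (m + 1) → Fin q, g (emb y (List.ofFn x)) =
      ((runLengths y).map fun r => g (r + 1)).sum := by
  induction y generalizing m with
  | nil =>
    subst hy
    simpa [h1, runLengths] using sum_emb_nil (q := q) g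
  | cons b y ih =>
    subst hy
    have := sum_emb_cons g h0 b y rfl
    simp only [List.length_cons]
    rw [this, ih rfl, h1]
    obtain ⟨k, rs, hk, he⟩ := emb_insert_head b y
    rw [he]
    by_cases hb : y.head? = some b
    · obtain ⟨z, rfl⟩ : ∃ z, y = b :: z := by
        cases y with
        | nil => simp at hb
        | cons c z => exact ⟨z, by simpa using hb⟩
      obtain ⟨k', rs', hk1, hk2⟩ := runLengths_cons_self b z
      rw [hk2] at hk
      obtain ⟨rfl, rfl⟩ := List.cons.inj hk
      rw [hk1, hk2]
      simp only [List.map_cons, List.sum_cons, add_assoc, Nat.reduceAdd]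
      ring
    · have hr := runLengths_cons_of_ne b y hb
      rw [hr] at hk
      obtain ⟨rfl, rfl⟩ := List.cons.inj hk
      rw [hr]
      simp [h1, add_comm]

lemma sum_runLengths {α : Type*} [DecidableEq α] (y : List α) :
    (runLengths y).sum = y.length := by
  induction y with
  | nil => rfl
  | cons b y ih =>
    by_cases hb : y.head? = some b
    · obtain ⟨z, rfl⟩ : ∃ z, y = b :: z := by
        cases y with
        | nil => simp at hb
        | cons c z => exact ⟨z, by simpa using hb⟩
      obtain ⟨k', rs', hk1, hk2⟩ := runLengths_cons_self b z
      rw [hk1] at ih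
      rw [hk2]
      simp at ih ⊢
      omega
    · rw [runLengths_cons_of_ne b y hb]
      simp [ih, add_comm]

lemma exists_runLengths_eq {α : Type*} [DecidableEq α] [Nontrivial α] (l : List ℕ)
    (hl : ∀ r ∈ l, 0 < r) (b : α) :
    ∃ y : List α, runLengths y = l ∧ ∀ c, y.head? = some c → c = b := by
  induction l generalizing b with
  | nil => exact ⟨[], rfl, by simp⟩
  | cons k l ih =>
    obtain ⟨k, rfl⟩ := Nat.exists_eq_succ_of_ne_zero (hl k (by simp)).ne'
    obtain ⟨a, ha⟩ := exists_ne b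
    obtain ⟨w, hw, hwa⟩ := ih (fun r hr => hl r (by simp [hr])) a
    suffices ∃ z : List α, runLengths (b :: z) = (k + 1) :: l by
      obtain ⟨z, hz⟩ := this
      exact ⟨b :: z, hz, by simp⟩
    clear hl
    induction k with
    | zero =>
      exact ⟨w, by rw [runLengths_cons_of_ne b w (fun h => ha (hwa b h).symm), hw]⟩
    | succ k ihk =>
      obtain ⟨z, hz⟩ := ihk
      obtain ⟨k', rs', hk1, hk2⟩ := runLengths_cons_self b z
      rw [hk1] at hz
      obtain ⟨h1, rfl⟩ := List.cons.inj hz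
      exact ⟨b :: z, by rw [hk2, ← h1]⟩

/-- The entropy of the 1-deletion channel depends only on the run length profile of the output. -/
lemma Hdel_one_eq {q m : ℕ} (hq : 2 ≤ q) (y : Fin m → Fin q) :
    Hdel q (m + 1) 1 y = Real.logb 2 (((m : ℝ) + 1) * q) -
      (((runLengths (List.ofFn y)).map
        fun r : ℕ => ((r : ℝ) + 1) * Real.logb 2 ((r : ℝ) + 1)).sum) / (((m : ℝ) + 1) * q) := by
  have hN : (0 : ℝ) < ((m : ℝ) + 1) * q := by positivity
  have hs := sum_emb (List.ofFn y) (List.length_ofFn)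
  have hr := sum_emb_eq_sum_runLengths (fun e : ℕ => (e : ℝ) * Real.logb 2 e) (by simp) (by simp)
    (List.ofFn y) (List.length_ofFn)
  have key : Hdel q (m + 1) 1 y = - ∑ x : Fin (m + 1) → Fin q,
      ((emb (List.ofFn y) (List.ofFn x) : ℝ) * Real.logb 2 (emb (List.ofFn y) (List.ofFn x)) /
        (((m : ℝ) + 1) * q) -
        (emb (List.ofFn y) (List.ofFn x) : ℝ) *
          (Real.logb 2 (((m : ℝ) + 1) * q) / (((m : ℝ) + 1) * q))) := by
    unfold Hdel
    rw [Finset.sum_filter]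
    congr 1
    refine Finset.sum_congr rfl fun x _ => ?_
    have hn : (((m + 1).choose 1 : ℕ) : ℝ) * (q : ℝ) ^ 1 = ((m : ℝ) + 1) * q := by simp
    change (if (List.ofFn y).Sublist (List.ofFn x) then
      ((emb (List.ofFn y) (List.ofFn x) : ℝ) / (((m + 1).choose 1 : ℕ) * (q : ℝ) ^ 1)) *
        Real.logb 2 ((emb (List.ofFn y) (List.ofFn x) : ℝ) / (((m + 1).choose 1 : ℕ) * (q : ℝ) ^ 1))
      else 0) = _
    rw [hn]
    by_cases he : emb (List.ofFn y) (List.ofFn x) = 0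
    · simp only [he, Nat.cast_zero, zero_div, zero_mul, ite_self, sub_self]
    · rw [if_pos (by by_contra h; exact he (emb_eq_zero h)),
        Real.logb_div (by exact_mod_cast he) hN.ne']
      ring
  rw [key, Finset.sum_sub_distrib, ← Finset.sum_div, ← Finset.sum_mul, hs, hr]
  push_cast
  field_simp
  ring

lemma secant_le {f : ℝ → ℝ} (hf : StrictConvexOn ℝ (Set.Ici 0) f) (d t : ℕ) :
    f d + ((t : ℝ) - d) * (f (d + 1) - f d) ≤ f t ∧
      (f d + ((t : ℝ) - d) * (f (d + 1) - f d) = f t ↔ t = d ∨ t = d + 1) := by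
  have ht0 : (t : ℝ) ∈ Set.Ici (0 : ℝ) := Set.mem_Ici.2 (Nat.cast_nonneg t)
  have hd0 : (d : ℝ) ∈ Set.Ici (0 : ℝ) := Set.mem_Ici.2 (Nat.cast_nonneg d)
  have hd1 : (d : ℝ) + 1 ∈ Set.Ici (0 : ℝ) := by simp only [Set.mem_Ici]; positivity
  by_cases h : t = d ∨ t = d + 1
  · have : f d + ((t : ℝ) - d) * (f (d + 1) - f d) = f t := by
      rcases h with rfl | rfl
      · simp
      · push_cast; ring
    exact ⟨this.le, iff_of_true this h⟩
  · suffices f d + ((t : ℝ) - d) * (f (d + 1) - f d) < f t from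
      ⟨this.le, iff_of_false this.ne h⟩
    rcases lt_or_ge t d with htd | htd
    · have h1 : (t : ℝ) < d := by exact_mod_cast htd
      have := hf.slope_strict_mono_adjacent ht0 hd1 h1 (lt_add_one _)
      rw [add_sub_cancel_left, div_one, div_lt_iff₀ (by linarith)] at this
      linarith
    · have h1 : (d : ℝ) + 1 < t := by
        have : d + 1 < t := by omega
        exact_mod_cast this
      have := hf.slope_strict_mono_adjacent hd0 ht0 (lt_add_one _) h1
      rw [add_sub_cancel_left, div_one, lt_div_iff₀ (by linarith)] at this
      linarith

lemma sum_secant {f : ℝ → ℝ} (hf : StrictConvexOn ℝ (Set.Ici 0) f) (d : ℕ) (l : List ℕ) :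
    l.length * f d + ((l.sum : ℝ) - l.length * d) * (f (d + 1) - f d) ≤
        (l.map fun r : ℕ => f r).sum ∧
      ((l.map fun r : ℕ => f r).sum =
        l.length * f d + ((l.sum : ℝ) - l.length * d) * (f (d + 1) - f d) ↔
          ∀ r ∈ l, r = d ∨ r = d + 1) := by
  induction l with
  | nil => simp
  | cons t l ih =>
    obtain ⟨h1, h2⟩ := secant_le hf d t
    obtain ⟨h3, h4⟩ := ih
    simp only [List.length_cons, List.sum_cons, List.map_cons, List.forall_mem_cons, ← h2, ← h4,
      Nat.cast_add, Nat.cast_one]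
    refine ⟨by linarith, fun h => ⟨by linarith, by linarith⟩, fun h => by linarith [h.1, h.2]⟩

lemma add_sub_one_div_of_mod_ne_zero {m R : ℕ} (hR : 0 < R) (h : m % R ≠ 0) :
    (m + R - 1) / R = m / R + 1 := by
  have hdiv := Nat.div_add_mod m R
  have hmod := Nat.mod_lt m hR
  rw [Nat.div_eq_iff hR, Nat.add_mul, Nat.mul_comm (m / R) R]
  generalize R * (m / R) = k at *
  omega

lemma isBalanced_iff {R : ℕ} (hR : 1 ≤ R) (l : List ℕ) (hl : l.length = R) :
    isBalanced l.sum R l ↔ ∀ r ∈ l, r = l.sum / R ∨ r = l.sum / R + 1 := by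
  set m := l.sum with hm
  have hdiv := Nat.div_add_mod m R
  have hmod := Nat.mod_lt m hR
  have hrep : List.replicate (m % R) ((m + R - 1) / R) = List.replicate (m % R) (m / R + 1) := by
    by_cases h : m % R = 0
    · simp [h]
    · rw [add_sub_one_div_of_mod_ne_zero hR h]
  unfold isBalanced
  rw [hrep]
  constructor
  · intro h r hr
    have := h.mem_iff.1 hr
    simp only [List.mem_append, List.mem_replicate] at this
    tauto
  · intro h
    have hperm : ∀ l : List ℕ, (∀ r ∈ l, r = m / R ∨ r = m / R + 1) → ∃ i ≤ l.length,
        l.Perm (List.replicate i (m / R + 1) ++ List.replicate (l.length - i) (m / R)) := by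
      intro l hl
      induction l with
      | nil => exact ⟨0, by simp⟩
      | cons a l ih =>
        obtain ⟨i, hi, hp⟩ := ih fun r hr => hl r (by simp [hr])
        rcases hl a (by simp) with rfl | rfl
        · refine ⟨i, by simp; omega, ?_⟩
          rw [List.length_cons, Nat.succ_sub hi, List.replicate_succ]
          exact (hp.cons _).trans List.perm_middle.symm
        · refine ⟨i + 1, by simpa using hi, ?_⟩
          rw [List.length_cons, Nat.add_sub_add_right, List.replicate_succ]
          exact hp.cons _
    obtain ⟨i, hi, hp⟩ := hperm l h
    have hsum := hp.sum_eq
    rw [← hm, hl] at hsum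
    rw [hl] at hi hp
    obtain ⟨j, rfl⟩ := Nat.exists_eq_add_of_le hi
    simp only [List.sum_append, List.sum_replicate, smul_eq_mul, Nat.add_sub_cancel_left] at hsum
    have : m % (i + j) = i := by nlinarith
    rw [this]
    exact hp

lemma strictConvexOn_add_one_mul_logb :
    StrictConvexOn ℝ (Set.Ici 0) fun x : ℝ => (x + 1) * Real.logb 2 (x + 1) := by
  have hlog : 0 < Real.log 2 := Real.log_pos (by norm_num)
  refine ⟨convex_Ici 0, fun x hx y hy hxy a b ha hb hab => ?_⟩
  simp only [Set.mem_Ici] at hx hy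
  have := Real.strictConvexOn_mul_log.2 (x := x + 1) (y := y + 1)
    (by simp only [Set.mem_Ici]; linarith) (by simp only [Set.mem_Ici]; linarith)
    (fun h => hxy (by linarith)) ha hb hab
  simp only [smul_eq_mul] at this ⊢
  have he : a * (x + 1) + b * (y + 1) = a * x + b * y + 1 := by linear_combination hab
  rw [he] at this
  have h2 := (div_lt_div_iff_of_pos_right hlog).2 this
  simp only [Real.logb]
  convert h2 using 1 <;> ring

/-- The extremal value of the entropy, rewritten through the secant line at `⌊m / R⌋`. -/
lemma entropy_value_eq (f : ℝ → ℝ) {m R : ℕ} (hR : 1 ≤ R) (L N : ℝ) :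
    L - (R * f (m / R : ℕ) + ((m : ℝ) - R * (m / R : ℕ)) *
        (f ((m / R : ℕ) + 1) - f (m / R : ℕ))) / N =
      L - ((m % R : ℕ) : ℝ) / N * f ((m + R - 1) / R : ℕ) -
        ((R - m % R : ℕ) : ℝ) / N * f (m / R : ℕ) := by
  have hdiv := Nat.div_add_mod m R
  have hmod := Nat.mod_lt m hR
  have hcast : (m : ℝ) - R * (m / R : ℕ) = (m % R : ℕ) := by
    rw [sub_eq_iff_eq_add']
    exact_mod_cast hdiv.symm
  rw [hcast, Nat.cast_sub hmod.le]
  by_cases h : m % R = 0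
  · rw [h]
    simp
    ring
  · rw [add_sub_one_div_of_mod_ne_zero hR h]
    push_cast
    ring

/-- For `n = m+1 ≥ 2`, `q ≥ 2`, `R ∈ [m]` and `r = m mod R`, the maximum of
`H^In_{1-Del}` over all channel outputs in `Σ_{q,R}^m` equals
`log₂(nq) - (r/(nq))(⌈m/R⌉+1)log₂(⌈m/R⌉+1) - ((R-r)/(nq))(⌊m/R⌋+1)log₂(⌊m/R⌋+1)`,
and it is attained exactly by the balanced channel outputs. -/
theorem stmt_6 (q m R : ℕ) (hq : 2 ≤ q) (hm : 1 ≤ m) (hR1 : 1 ≤ R) (hRm : R ≤ m) :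
    IsGreatest
      ((fun y : Fin m → Fin q => Hdel q (m + 1) 1 y) ''
        {y | (runLengths (List.ofFn y)).length = R})
      (Real.logb 2 (((m : ℝ) + 1) * q)
        - ((m % R : ℕ) : ℝ) / (((m : ℝ) + 1) * q) *
            ((((m + R - 1) / R : ℕ) : ℝ) + 1) *
              Real.logb 2 ((((m + R - 1) / R : ℕ) : ℝ) + 1)
        - ((R - m % R : ℕ) : ℝ) / (((m : ℝ) + 1) * q) *
            (((m / R : ℕ) : ℝ) + 1) * Real.logb 2 (((m / R : ℕ) : ℝ) + 1))
    ∧ ∀ y : Fin m → Fin q, (runLengths (List.ofFn y)).length = R →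
        (Hdel q (m + 1) 1 y =
          Real.logb 2 (((m : ℝ) + 1) * q)
            - ((m % R : ℕ) : ℝ) / (((m : ℝ) + 1) * q) *
                ((((m + R - 1) / R : ℕ) : ℝ) + 1) *
                  Real.logb 2 ((((m + R - 1) / R : ℕ) : ℝ) + 1)
            - ((R - m % R : ℕ) : ℝ) / (((m : ℝ) + 1) * q) *
                (((m / R : ℕ) : ℝ) + 1) * Real.logb 2 (((m / R : ℕ) : ℝ) + 1)
          ↔ isBalanced m R (runLengths (List.ofFn y))) := by
  set f : ℝ → ℝ := fun x => (x + 1) * Real.logb 2 (x + 1) with hf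
  have hN : (0 : ℝ) < ((m : ℝ) + 1) * q := by positivity
  have hval := entropy_value_eq f (m := m) hR1 (Real.logb 2 (((m : ℝ) + 1) * q))
    (((m : ℝ) + 1) * q)
  generalize hV : Real.logb 2 (((m : ℝ) + 1) * q) - (R * f (m / R : ℕ) +
    ((m : ℝ) - R * (m / R : ℕ)) * (f ((m / R : ℕ) + 1) - f (m / R : ℕ))) /
      (((m : ℝ) + 1) * q) = V at hval
  simp only [hf, ← mul_assoc] at hval
  rw [← hval]
  have hsec : ∀ y : Fin m → Fin q, (runLengths (List.ofFn y)).length = R → _ := fun y _ =>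
    sum_secant strictConvexOn_add_one_mul_logb (m / R) (runLengths (List.ofFn y))
  have hsum : ∀ y : Fin m → Fin q, (runLengths (List.ofFn y)).sum = m := fun y => by
    rw [sum_runLengths, List.length_ofFn]
  have hiff : ∀ y : Fin m → Fin q, (runLengths (List.ofFn y)).length = R →
      (Hdel q (m + 1) 1 y = V ↔ isBalanced m R (runLengths (List.ofFn y))) := by
    intro y hy
    have h1 := (hsec y hy).2
    have h2 := isBalanced_iff hR1 _ hy
    rw [hsum y] at h1 h2
    rw [hy] at h1
    rw [h2, ← h1, Hdel_one_eq hq, ← hV, sub_right_inj, div_left_inj' hN.ne']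
  refine ⟨⟨?_, ?_⟩, hiff⟩
  · have hmod := Nat.mod_lt m hR1
    have : Nontrivial (Fin q) := Fin.nontrivial_iff_two_le.2 hq
    set l := List.replicate (m % R) ((m + R - 1) / R) ++ List.replicate (R - m % R) (m / R) with hl
    have hlen : l.length = R := by simp [hl]; omega
    have hpos : ∀ r ∈ l, 0 < r := by
      intro r hr
      have h1 : 0 < m / R := Nat.div_pos hRm hR1
      have h2 : m / R ≤ (m + R - 1) / R := Nat.div_le_div_right (by omega)
      simp only [hl, List.mem_append, List.mem_replicate] at hr
      omega
    have hlsum : l.sum = m := by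
      have hdiv := Nat.div_add_mod m R
      obtain ⟨j, hj⟩ := Nat.exists_eq_add_of_le hmod.le
      have h1 : R - m % R = j := by omega
      simp only [hl, List.sum_append, List.sum_replicate, smul_eq_mul, h1]
      by_cases h : m % R = 0
      · rw [h] at hj hdiv ⊢
        simp at hj hdiv ⊢
        rw [← hj]
        exact hdiv
      · rw [add_sub_one_div_of_mod_ne_zero hR1 h]
        nlinarith
    obtain ⟨w, hw, -⟩ := exists_runLengths_eq l hpos (⟨0, by omega⟩ : Fin q)
    have hwm : w.length = m := by rw [← sum_runLengths, hw, hlsum]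
    obtain ⟨y, rfl⟩ : ∃ y : Fin m → Fin q, List.ofFn y = w := by
      subst hwm
      exact ⟨w.get, List.ofFn_get w⟩
    have hy : (runLengths (List.ofFn y)).length = R := by rw [hw, hlen]
    exact ⟨y, hy, (hiff y hy).2 (by rw [hw]; exact List.Perm.refl _)⟩
  · rintro _ ⟨y, hy, rfl⟩
    have h1 := (hsec y hy).1
    rw [hsum y, hy] at h1
    change Hdel q (m + 1) 1 y ≤ _
    rw [Hdel_one_eq hq, ← hV]
    gcongr

end
end

section
/- For every integer n ≥ 1 and every integer q ≥ 2, the maximum of the input entropy H^In_{1-Ins}(y) over all channel outputs y ∈ Σ_q^{n+1} equals log₂(n+1), and it is attained exactly by the words y ∈ Σ_q^{n+1} with ρ(y) = n+1 runs (i.e., all runs of length one). -/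
open scoped Classical

noncomputable section

lemma count_sublists'_eq_count_sublistsLen {α : Type*} [DecidableEq α] (x l : List α) :
    l.sublists'.count x = (List.sublistsLen x.length l).count x := by
  rw [← (List.range_bind_sublistsLen_perm l).count_eq x, List.count_flatMap]
  rcases lt_or_ge l.length x.length with h | h
  · rw [List.sublistsLen_of_length_lt h, List.count_nil]
    refine List.sum_eq_zero fun k hk => ?_
    obtain ⟨i, hi, rfl⟩ := List.mem_map.1 hk
    refine List.count_eq_zero.2 fun hx => ?_
    have := List.length_of_sublistsLen hx
    have := List.mem_range.1 hi
    omega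
  · rw [← List.sum_toFinset _ (List.nodup_range),
      Finset.sum_eq_single x.length]
    · rfl
    · intro i _ hne
      exact List.count_eq_zero.2 fun hx => hne (List.length_of_sublistsLen hx).symm
    · intro hx
      simp only [List.mem_toFinset, List.mem_range] at hx
      omega

lemma emb_eq_count_sublistsLen {q : ℕ} (x l : List (Fin q)) :
    emb x l = (List.sublistsLen x.length l).count x := by
  rw [emb, (List.sublists_perm_sublists' l).count_eq, count_sublists'_eq_count_sublistsLen]

lemma emb_pos_iff {q : ℕ} (x l : List (Fin q)) : 0 < emb x l ↔ x.Sublist l := by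
  rw [emb, List.count_pos_iff, List.mem_sublists]

lemma sum_emb_eq_choose {q n : ℕ} (l : List (Fin q)) :
    ∑ x ∈ Finset.univ.filter (fun x : Fin n → Fin q => (List.ofFn x).Sublist l),
      emb (List.ofFn x) l = l.length.choose n := by
  rw [← List.length_sublistsLen, ← List.sum_toFinset_count_eq_length]
  refine Finset.sum_nbij List.ofFn ?_ (List.ofFn_injective.injOn) ?_ ?_
  · intro x hx
    simpa [List.mem_sublistsLen] using hx
  · intro w hw
    obtain ⟨hs, rfl⟩ := List.mem_sublistsLen.1 (List.mem_toFinset.1 hw)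
    exact ⟨w.get, by simpa using hs, List.ofFn_get w⟩
  · intro x _
    rw [emb_eq_count_sublistsLen, List.length_ofFn]
    congr!

lemma nodup_sublistsLen_pred_iff {α : Type*} (a : α) (l : List α) :
    (List.sublistsLen l.length (a :: l)).Nodup ↔ (a :: l).IsChain (· ≠ ·) := by
  induction l generalizing a with
  | nil => simp
  | cons b l ih =>
    rw [List.length_cons, List.sublistsLen_succ_cons, ← List.length_cons (a := b),
      List.sublistsLen_length, List.isChain_cons_cons, ← ih, List.singleton_append,
      List.nodup_cons, List.nodup_map_iff (List.cons_injective)]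
    refine and_congr_left fun _ => not_congr ?_
    simp only [List.mem_map, List.cons.injEq, List.mem_sublistsLen]
    exact ⟨fun ⟨_, _, h, _⟩ => h, fun h => ⟨l, ⟨List.sublist_cons_self b l, rfl⟩, h, rfl⟩⟩

lemma length_runLengths_cons_cons {α : Type*} [DecidableEq α] (a b : α) (l : List α) :
    (runLengths (a :: b :: l)).length =
      if a = b then max 1 (runLengths (b :: l)).length else (runLengths (b :: l)).length + 1 := by
  rw [runLengths]
  split_ifs with h
  · cases runLengths (b :: l) <;> simp
  · simp

lemma length_runLengths_le {α : Type*} [DecidableEq α] (a : α) (l : List α) :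
    (runLengths (a :: l)).length ≤ l.length + 1 := by
  induction l generalizing a with
  | nil => simp [runLengths]
  | cons b l ih =>
    have := ih b
    rw [length_runLengths_cons_cons, List.length_cons]
    split_ifs <;> omega

lemma length_runLengths_eq_iff {α : Type*} [DecidableEq α] (a : α) (l : List α) :
    (runLengths (a :: l)).length = l.length + 1 ↔ (a :: l).IsChain (· ≠ ·) := by
  induction l generalizing a with
  | nil => simp [runLengths]
  | cons b l ih =>
    have := length_runLengths_le b l
    rw [length_runLengths_cons_cons, List.length_cons, List.isChain_cons_cons, ← ih]
    split_ifs with h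
    · simp only [h, ne_eq, not_true_eq_false, false_and, iff_false]
      omega
    · simp [h]

lemma emb_le_one_iff_length_runLengths {q n : ℕ} (y : Fin (n + 1) → Fin q) :
    (∀ x : Fin n → Fin q, emb (List.ofFn x) (List.ofFn y) ≤ 1) ↔
      (runLengths (List.ofFn y)).length = n + 1 := by
  obtain ⟨a, l, hy, rfl⟩ : ∃ a l, List.ofFn y = a :: l ∧ l.length = n :=
    ⟨_, _, List.ofFn_succ, List.length_ofFn⟩
  rw [hy, length_runLengths_eq_iff, ← nodup_sublistsLen_pred_iff, List.nodup_iff_count_le_one]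
  constructor
  · intro h w
    by_cases hw : w ∈ List.sublistsLen l.length (a :: l)
    · have hlen := (List.mem_sublistsLen.1 hw).2
      have := h (fun i => w.get (i.cast hlen.symm))
      have hx : List.ofFn (fun i : Fin l.length => w.get (i.cast hlen.symm)) = w := by
        rw [← List.ofFn_congr hlen, List.ofFn_get]
      rwa [hx, emb_eq_count_sublistsLen, hlen] at this
    · simp [List.count_eq_zero.2 hw]
  · intro h x
    simpa [emb_eq_count_sublistsLen] using h (List.ofFn x)

/-- The entropy deficit of the `1`-insertion channel, as a sum of nonnegative terms. -/
lemma Hins_one_eq {q n : ℕ} (y : Fin (n + 1) → Fin q) :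
    Hins q n 1 y = Real.logb 2 ((n : ℝ) + 1) -
      (∑ x ∈ Finset.univ.filter
          (fun x : Fin n → Fin q => (List.ofFn x).Sublist (List.ofFn y)),
        (emb (List.ofFn x) (List.ofFn y) : ℝ) *
          Real.logb 2 (emb (List.ofFn x) (List.ofFn y))) / ((n : ℝ) + 1) := by
  have hsum := sum_emb_eq_choose (n := n) (List.ofFn y)
  rw [List.length_ofFn, Nat.choose_succ_self_right] at hsum
  have hsum' := congrArg (Nat.cast (R := ℝ)) hsum
  push_cast at hsum'
  have hn : (n : ℝ) + 1 ≠ 0 := by positivity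
  have hterm : ∀ x ∈ Finset.univ.filter
      (fun x : Fin n → Fin q => (List.ofFn x).Sublist (List.ofFn y)),
      ((emb (List.ofFn x) (List.ofFn y) : ℝ) / ((n + 1).choose 1 : ℝ)) *
        Real.logb 2 ((emb (List.ofFn x) (List.ofFn y) : ℝ) / ((n + 1).choose 1 : ℝ)) =
      ((emb (List.ofFn x) (List.ofFn y) : ℝ) *
          Real.logb 2 (emb (List.ofFn x) (List.ofFn y))) / ((n : ℝ) + 1) -
        (emb (List.ofFn x) (List.ofFn y) : ℝ) * (Real.logb 2 ((n : ℝ) + 1) / ((n : ℝ) + 1)) := by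
    intro x hx
    have hpos := (emb_pos_iff _ _).2 (Finset.mem_filter.1 hx).2
    have hne : (emb (List.ofFn x) (List.ofFn y) : ℝ) ≠ 0 := by exact_mod_cast hpos.ne'
    rw [Nat.choose_one_right, Nat.cast_add_one, Real.logb_div hne hn]
    ring
  rw [Hins, Finset.sum_congr rfl hterm, Finset.sum_sub_distrib, ← Finset.sum_div,
    ← Finset.sum_mul, hsum']
  field_simp
  ring

lemma natCast_mul_logb_nonneg (c : ℕ) : 0 ≤ (c : ℝ) * Real.logb 2 c := by
  rcases Nat.eq_zero_or_pos c with rfl | hc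
  · simp
  · exact mul_nonneg c.cast_nonneg (Real.logb_nonneg one_lt_two (by exact_mod_cast hc))

lemma natCast_mul_logb_eq_zero_iff (c : ℕ) : (c : ℝ) * Real.logb 2 c = 0 ↔ c ≤ 1 := by
  constructor
  · contrapose!
    intro hc
    exact (mul_pos (by exact_mod_cast one_pos.trans hc)
      (Real.logb_pos one_lt_two (by exact_mod_cast hc))).ne'
  · intro hc
    interval_cases c <;> simp

lemma Hins_one_le {q n : ℕ} (y : Fin (n + 1) → Fin q) :
    Hins q n 1 y ≤ Real.logb 2 ((n : ℝ) + 1) := by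
  rw [Hins_one_eq]
  exact sub_le_self _ (div_nonneg
    (Finset.sum_nonneg fun x _ => natCast_mul_logb_nonneg _) (by positivity))

lemma Hins_one_eq_logb_iff {q n : ℕ} (y : Fin (n + 1) → Fin q) :
    Hins q n 1 y = Real.logb 2 ((n : ℝ) + 1) ↔ (runLengths (List.ofFn y)).length = n + 1 := by
  have hn : (n : ℝ) + 1 ≠ 0 := by positivity
  rw [← emb_le_one_iff_length_runLengths, Hins_one_eq, sub_eq_self, div_eq_zero_iff,
    or_iff_left hn, Finset.sum_eq_zero_iff_of_nonneg fun x _ => natCast_mul_logb_nonneg _]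
  simp only [natCast_mul_logb_eq_zero_iff, Finset.mem_filter, Finset.mem_univ, true_and]
  refine forall_congr' fun x => ⟨fun h => ?_, fun h _ => h⟩
  by_contra hlt
  exact hlt (h ((emb_pos_iff _ _).1 (by omega)))

lemma exists_length_runLengths_eq {q : ℕ} (n : ℕ) (hq : 2 ≤ q) :
    ∃ y : Fin (n + 1) → Fin q, (runLengths (List.ofFn y)).length = n + 1 := by
  let y : Fin (n + 1) → Fin q := fun i => ⟨i % 2, (Nat.mod_lt _ two_pos).trans_le hq⟩
  refine ⟨y, ?_⟩
  have hchain : (List.ofFn y).IsChain (· ≠ ·) := by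
    rw [List.isChain_iff_getElem]
    intro i hi
    simp only [List.getElem_ofFn, y, ne_eq, Fin.mk.injEq]
    omega
  rw [List.ofFn_succ] at hchain ⊢
  simpa using (length_runLengths_eq_iff _ _).2 hchain

/-- For `n ≥ 1` and `q ≥ 2`, the maximum input entropy of the `1`-insertion channel over
all channel outputs in `Σ_q^{n+1}` equals `log₂(n+1)`, and it is attained exactly by the
channel outputs with `n+1` runs. -/
theorem stmt_11 (q n : ℕ) (hq : 2 ≤ q) (hn : 1 ≤ n) :
    IsGreatest ((fun y : Fin (n + 1) → Fin q => Hins q n 1 y) '' Set.univ)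
      (Real.logb 2 ((n : ℝ) + 1))
    ∧ ∀ y : Fin (n + 1) → Fin q,
        (Hins q n 1 y = Real.logb 2 ((n : ℝ) + 1)
          ↔ (runLengths (List.ofFn y)).length = n + 1) := by
  obtain ⟨y, hy⟩ := exists_length_runLengths_eq n hq
  refine ⟨⟨⟨y, Set.mem_univ y, (Hins_one_eq_logb_iff y).2 hy⟩, ?_⟩, Hins_one_eq_logb_iff⟩
  rintro _ ⟨z, -, rfl⟩
  exact Hins_one_le z

end
end

section
/- Let n ≥ 1, q ≥ 2, m = n+1, and R ∈ {1,…,m}. The minimum of H^In_{1-Ins}(y) over all y ∈ Σ_{q,R}^m equals log₂(m) − ((m−R+1) log₂(m−R+1))/m, and this minimum is attained exactly by the skewed words of Σ_{q,R}^m. -/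
open scoped Classical

noncomputable section

/-- The multiset of all words obtained by deleting one symbol of a word, with multiplicity. -/
def singleDeletions {α : Type*} : List α → Multiset (List α)
  | [] => 0
  | a :: l => l ::ₘ (singleDeletions l).map (List.cons a)

/-- The sum of `g` over the multiplicities of the distinct elements of a multiset. -/
def multiplicitySum {β : Type*} [DecidableEq β] (g : ℕ → ℝ) (M : Multiset β) : ℝ :=
  ∑ x ∈ M.toFinset, g (M.count x)

lemma multiplicitySum_map {β γ : Type*} [DecidableEq β] [DecidableEq γ] (g : ℕ → ℝ)
    (M : Multiset β) {f : β → γ} (hf : Function.Injective f) :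
    multiplicitySum g (M.map f) = multiplicitySum g M := by
  unfold multiplicitySum
  rw [Multiset.toFinset_map, Finset.sum_image hf.injOn]
  simp [Multiset.count_map_eq_count' f M hf]

lemma multiplicitySum_eq_sum {β : Type*} [DecidableEq β] {g : ℕ → ℝ} (hg : g 0 = 0)
    (M : Multiset β) {s : Finset β} (hs : M.toFinset ⊆ s) :
    multiplicitySum g M = ∑ x ∈ s, g (M.count x) := by
  refine Finset.sum_subset hs fun x _ hx => ?_
  rw [Multiset.count_eq_zero_of_notMem (by simpa using hx), hg]

lemma multiplicitySum_cons {β : Type*} [DecidableEq β] {g : ℕ → ℝ} (hg : g 0 = 0)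
    (M : Multiset β) (a : β) :
    multiplicitySum g (a ::ₘ M) =
      multiplicitySum g M + (g (M.count a + 1) - g (M.count a)) := by
  have ha : a ∈ (a ::ₘ M).toFinset := by simp
  rw [multiplicitySum_eq_sum hg M (s := (a ::ₘ M).toFinset)
    (by rw [Multiset.toFinset_cons]; exact Finset.subset_insert _ _), multiplicitySum,
    ← Finset.add_sum_erase _ _ ha, ← Finset.add_sum_erase _ _ ha, Multiset.count_cons_self]
  have h : ∑ x ∈ (a ::ₘ M).toFinset.erase a, g ((a ::ₘ M).count x) =
      ∑ x ∈ (a ::ₘ M).toFinset.erase a, g (M.count x) :=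
    Finset.sum_congr rfl fun x hx => by
      rw [Multiset.count_cons_of_ne (Finset.ne_of_mem_erase hx)]
  rw [h]
  ring

section RunLengths

variable {α : Type*} [DecidableEq α]

lemma runLengths_cons_ne_nil (a : α) (l : List α) : runLengths (a :: l) ≠ [] := by
  cases l with
  | nil => simp [runLengths]
  | cons b l =>
    rw [runLengths]
    split_ifs
    · split <;> simp
    · simp

lemma runLengths_cons_of_ne_s12 {a b : α} (h : a ≠ b) (l : List α) :
    runLengths (a :: b :: l) = 1 :: runLengths (b :: l) := by
  rw [runLengths, if_neg h]

lemma runLengths_cons_self_s12 {a : α} {l : List α} {r : ℕ} {rs : List ℕ}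
    (h : runLengths (a :: l) = r :: rs) :
    runLengths (a :: a :: l) = (r + 1) :: rs := by
  rw [runLengths, if_pos rfl, h]

lemma sum_runLengths_s12 (l : List α) : (runLengths l).sum = l.length := by
  induction l with
  | nil => rfl
  | cons a l ih =>
    cases l with
    | nil => rfl
    | cons b l =>
      by_cases h : a = b
      · subst h
        obtain ⟨r, rs, hr⟩ := List.exists_cons_of_ne_nil (runLengths_cons_ne_nil a l)
        rw [runLengths_cons_self_s12 hr]
        rw [hr] at ih
        simp at ih ⊢
        omega
      · rw [runLengths_cons_of_ne_s12 h]
        simp at ih ⊢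
        omega

lemma one_le_of_mem_runLengths (l : List α) : ∀ r ∈ runLengths l, 1 ≤ r := by
  induction l with
  | nil => simp [runLengths]
  | cons a l ih =>
    cases l with
    | nil => simp [runLengths]
    | cons b l =>
      by_cases h : a = b
      · subst h
        obtain ⟨r, rs, hr⟩ := List.exists_cons_of_ne_nil (runLengths_cons_ne_nil a l)
        rw [runLengths_cons_self_s12 hr]
        rw [hr] at ih
        simp at ih ⊢
        exact ih.2
      · rw [runLengths_cons_of_ne_s12 h]
        simpa using ih

/-- Over an alphabet with at least two symbols every list of positive integers is the run length
profile of some word, whose first symbol can be prescribed. -/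
lemma exists_runLengths_eq_s12 [Nontrivial α] (rs : List ℕ) (hrs : ∀ r ∈ rs, 1 ≤ r) (r : ℕ) (a : α) :
    ∃ l : List α, runLengths (a :: l) = (r + 1) :: rs := by
  induction rs generalizing r a with
  | nil =>
    induction r with
    | zero => exact ⟨[], rfl⟩
    | succ r ih =>
      obtain ⟨l, hl⟩ := ih
      exact ⟨a :: l, runLengths_cons_self_s12 hl⟩
  | cons s rs ih =>
    induction r with
    | zero =>
      obtain ⟨b, hb⟩ := exists_ne a
      obtain ⟨s, rfl⟩ := Nat.exists_eq_add_of_le' (hrs s (by simp))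
      obtain ⟨l, hl⟩ := ih (fun r hr => hrs r (by simp [hr])) s b
      exact ⟨b :: l, by rw [runLengths_cons_of_ne_s12 hb.symm, hl]⟩
    | succ r ihr =>
      obtain ⟨l, hl⟩ := ihr
      exact ⟨a :: l, runLengths_cons_self_s12 hl⟩

lemma count_map_cons_of_ne {a b : α} (h : a ≠ b) (l : List α) (M : Multiset (List α)) :
    (M.map (List.cons a)).count (b :: l) = 0 := by
  refine Multiset.count_eq_zero_of_notMem fun hm => ?_
  obtain ⟨t, -, ht⟩ := Multiset.mem_map.1 hm
  exact h (List.cons.inj ht).1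

lemma count_map_cons_self (a : α) (l : List α) (M : Multiset (List α)) :
    (M.map (List.cons a)).count (a :: l) = M.count l :=
  Multiset.count_map_eq_count' _ M (List.cons_injective) l

/-- Deleting the first symbol and deleting any other symbol of the first run give the same word. -/
lemma head_runLengths (a : α) (l : List α) :
    (runLengths (a :: l)).head? = some ((singleDeletions (a :: l)).count l) := by
  induction l generalizing a with
  | nil => simp [runLengths, singleDeletions]
  | cons b l ih =>
    rw [singleDeletions, Multiset.count_cons_self]
    by_cases h : a = b
    · subst h
      obtain ⟨r, rs, hr⟩ := List.exists_cons_of_ne_nil (runLengths_cons_ne_nil a l)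
      have := ih a
      rw [hr] at this
      rw [runLengths_cons_self_s12 hr, count_map_cons_self]
      simpa using this
    · rw [runLengths_cons_of_ne_s12 h, count_map_cons_of_ne h]
      rfl

lemma multiplicitySum_singleDeletions {g : ℕ → ℝ} (hg : g 0 = 0) (l : List α) :
    multiplicitySum g (singleDeletions l) = ((runLengths l).map g).sum := by
  induction l with
  | nil => simp [multiplicitySum, singleDeletions, runLengths]
  | cons a l ih =>
    rw [singleDeletions, multiplicitySum_cons hg,
      multiplicitySum_map _ _ List.cons_injective, ih]
    cases l with
    | nil => simp [runLengths, singleDeletions, hg]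
    | cons b l =>
      by_cases h : a = b
      · subst h
        obtain ⟨r, rs, hr⟩ := List.exists_cons_of_ne_nil (runLengths_cons_ne_nil a l)
        have hc := head_runLengths a l
        rw [hr] at hc
        have hc' : r = (singleDeletions (a :: l)).count l := by simpa using hc
        rw [runLengths_cons_self_s12 hr, hr, count_map_cons_self, ← hc']
        simp
        ring
      · rw [runLengths_cons_of_ne_s12 h, count_map_cons_of_ne h]
        simp [hg]
        ring

lemma count_sublists'_of_length_le {x l : List α} (h : l.length ≤ x.length) :
    l.sublists'.count x = if x = l then 1 else 0 := by
  induction l generalizing x with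
  | nil =>
    by_cases hx : x = []
    · simp [hx]
    · rw [if_neg hx, List.count_eq_zero_of_not_mem (by simpa using hx)]
  | cons a l ih =>
    cases x with
    | nil => simp at h
    | cons b x =>
      simp only [List.length_cons, add_le_add_iff_right] at h
      have h0 : l.sublists'.count (b :: x) = 0 := by
        refine List.count_eq_zero_of_not_mem fun hm => ?_
        have := (List.mem_sublists'.1 hm).length_le
        simp at this
        omega
      rw [List.sublists'_cons, List.count_append, h0, zero_add]
      by_cases hab : a = b
      · subst hab
        rw [List.count_map_of_injective _ _ List.cons_injective, ih h]
        simp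
      · rw [if_neg (by simp [Ne.symm hab]), List.count_eq_zero_of_not_mem]
        simp [hab]

lemma count_sublists_eq_count_singleDeletions {x l : List α} (h : l.length = x.length + 1) :
    l.sublists.count x = (singleDeletions l).count x := by
  rw [(List.sublists_perm_sublists' l).count_eq]
  induction l generalizing x with
  | nil => simp at h
  | cons a l ih =>
    simp only [List.length_cons, add_left_inj] at h
    rw [List.sublists'_cons, List.count_append, count_sublists'_of_length_le h.le,
      singleDeletions, Multiset.count_cons, add_comm]
    congr 1
    cases x with
    | nil =>
      rw [List.count_eq_zero_of_not_mem (by simp), Multiset.count_eq_zero_of_notMem (by simp)]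
    | cons b x =>
      by_cases hab : a = b
      · subst hab
        rw [List.count_map_of_injective _ _ List.cons_injective, count_map_cons_self]
        exact ih h
      · rw [count_map_cons_of_ne hab, List.count_eq_zero_of_not_mem]
        simp [hab]

end RunLengths

lemma Hins_one_eq_sum_runLengths {q n : ℕ} (y : Fin (n + 1) → Fin q) :
    Hins q n 1 y = -((runLengths (List.ofFn y)).map fun r : ℕ =>
      ((r : ℝ) / ((n : ℝ) + 1)) * Real.logb 2 ((r : ℝ) / ((n : ℝ) + 1))).sum := by
  set g : ℕ → ℝ := fun r => ((r : ℝ) / ((n : ℝ) + 1)) * Real.logb 2 ((r : ℝ) / ((n : ℝ) + 1))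
    with hgdef
  have hg : g 0 = 0 := by simp [hgdef]
  have hcount (x : Fin n → Fin q) : emb (List.ofFn x) (List.ofFn y) =
      (singleDeletions (List.ofFn y)).count (List.ofFn x) := by
    rw [← count_sublists_eq_count_singleDeletions (by simp), emb]
  have hmem {x : List (Fin q)} (hx : x ∈ singleDeletions (List.ofFn y)) : x.length = n ∧
      x.Sublist (List.ofFn y) := by
    have key : ∀ (l : List (Fin q)) {x}, x ∈ singleDeletions l →
        x.length + 1 = l.length ∧ x.Sublist l := by
      intro l
      induction l with
      | nil => simp [singleDeletions]
      | cons a l ih =>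
        intro x hx
        rw [singleDeletions, Multiset.mem_cons, Multiset.mem_map] at hx
        rcases hx with rfl | ⟨t, ht, rfl⟩
        · simp
        · simpa using ih ht
    simpa using key _ hx
  rw [← multiplicitySum_singleDeletions hg, Hins]
  congr 1
  rw [multiplicitySum_eq_sum hg _ (s := (Finset.univ.filter
      (fun x : Fin n → Fin q => (List.ofFn x).Sublist (List.ofFn y))).image List.ofFn),
    Finset.sum_image List.ofFn_injective.injOn]
  · refine Finset.sum_congr rfl fun x _ => ?_
    rw [hcount]
    simp [hgdef]
  · intro x hx
    obtain ⟨hlen, hsub⟩ := hmem (Multiset.mem_toFinset.1 hx)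
    subst hlen
    simp only [Finset.mem_image, Finset.mem_filter, Finset.mem_univ, true_and]
    exact ⟨x.get, by simpa using hsub, by simp⟩

lemma mul_log_lt_chord {x N : ℝ} (h1 : 1 < x) (hN : x < N) :
    x * Real.log x < (x - 1) * (N * Real.log N / (N - 1)) := by
  have hd : 0 < N - 1 := by linarith
  have h1mem : (1 : ℝ) ∈ Set.Ici 0 := Set.mem_Ici.2 zero_le_one
  have hNmem : N ∈ Set.Ici 0 := by
    rw [Set.mem_Ici]
    linarith
  have hab : (N - x) / (N - 1) + (x - 1) / (N - 1) = 1 := by field_simp; ring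
  have h := Real.strictConvexOn_mul_log.2 h1mem hNmem (h1.trans hN).ne
    (div_pos (sub_pos.2 hN) hd) (div_pos (sub_pos.2 h1) hd) hab
  have hx : (N - x) / (N - 1) * 1 + (x - 1) / (N - 1) * N = x := by field_simp; ring
  simp only [smul_eq_mul, hx, Real.log_one, mul_zero, zero_add] at h
  calc x * Real.log x < _ := h
    _ = _ := by ring

lemma sum_mul_log_of_isSkewed {m R : ℕ} {L : List ℕ} (h : isSkewed m R L) :
    (L.map fun r : ℕ => (r : ℝ) * Real.log r).sum =
      ((m - (R - 1) : ℕ) : ℝ) * Real.log ((m - (R - 1) : ℕ) : ℝ) := by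
  rw [(h.map _).sum_eq]
  simp

/-- Among positive integer sequences with given sum and length, `∑ r log r` is largest exactly for
the skewed ones. -/
lemma sum_mul_log_lt_of_not_isSkewed {L : List ℕ} (hL : L ≠ []) (hpos : ∀ r ∈ L, 1 ≤ r)
    (h : ¬ isSkewed L.sum L.length L) :
    (L.map fun r : ℕ => (r : ℝ) * Real.log r).sum <
      ((L.sum - (L.length - 1) : ℕ) : ℝ) * Real.log ((L.sum - (L.length - 1) : ℕ) : ℝ) := by
  set N := L.sum - (L.length - 1) with hN
  have hlen : 0 < L.length := List.length_pos_of_ne_nil hL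
  have hsum : L.length ≤ L.sum := List.length_le_sum_of_one_le L hpos
  have herase {r : ℕ} (hr : r ∈ L) : r + (L.erase r).sum = L.sum ∧
      (L.erase r).length + 1 = L.length ∧ (L.erase r).length ≤ (L.erase r).sum := by
    refine ⟨List.sum_erase hr, ?_, List.length_le_sum_of_one_le _ fun s hs =>
      hpos s (List.mem_of_mem_erase hs)⟩
    rw [List.length_erase_of_mem hr]
    omega
  have hle {r : ℕ} (hr : r ∈ L) : r ≤ N := by
    have := herase hr
    omega
  have hNmem : N ∉ L := fun hm => h <| by
    obtain ⟨h1, h2, h3⟩ := herase hm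
    refine (List.perm_cons_erase hm).trans (List.Perm.cons _ ?_)
    have hrep : L.erase N = List.replicate (L.length - 1) 1 := by
      refine List.eq_replicate_iff.2 ⟨by omega, fun s hs => ?_⟩
      have hs' := (List.perm_cons_erase hs)
      have hs1 := hpos s (List.mem_of_mem_erase hs)
      have e1 := hs'.sum_eq
      have e2 := hs'.length_eq
      have e3 := List.length_le_sum_of_one_le ((L.erase N).erase s) fun t ht =>
        hpos t (List.mem_of_mem_erase (List.mem_of_mem_erase ht))
      simp only [List.sum_cons, List.length_cons] at e1 e2
      omega
    rw [hrep]
  have hlt {r : ℕ} (hr : r ∈ L) : r < N := lt_of_le_of_ne (hle hr) fun e => hNmem (e ▸ hr)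
  obtain ⟨r, hr, hr1⟩ : ∃ r ∈ L, 1 < r := by
    by_contra! hall
    have hrep : L = List.replicate L.length 1 :=
      List.eq_replicate_iff.2 ⟨rfl, fun s hs => le_antisymm (hall s hs) (hpos s hs)⟩
    have hs : L.sum = L.length := by
      conv_lhs => rw [hrep]
      simp
    obtain ⟨s, hs'⟩ := List.exists_mem_of_ne_nil L hL
    have := hlt hs'
    have := hpos s hs'
    omega
  have hN1 : (1 : ℝ) < N := by exact_mod_cast hr1.trans (hlt hr)
  have hstrict {s : ℕ} (hs : s ∈ L) (hs1 : 1 < s) :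
      (s : ℝ) * Real.log s < ((s : ℝ) - 1) * (N * Real.log N / (N - 1)) :=
    mul_log_lt_chord (by exact_mod_cast hs1) (by exact_mod_cast hlt hs)
  have hfactor : ∀ K : List ℕ, ∀ c : ℝ,
      (K.map fun s : ℕ => ((s : ℝ) - 1) * c).sum = ((K.sum : ℝ) - K.length) * c := by
    intro K c
    induction K with
    | nil => simp
    | cons s K ih =>
      simp only [List.map_cons, List.sum_cons, ih, List.length_cons]
      push_cast
      ring
  calc (L.map fun r : ℕ => (r : ℝ) * Real.log r).sum
      < (L.map fun s : ℕ => ((s : ℝ) - 1) * (N * Real.log N / (N - 1))).sum := by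
        refine List.sum_lt_sum _ _ (fun s hs => ?_) ⟨r, hr, hstrict hr hr1⟩
        rcases (hpos s hs).eq_or_lt with rfl | hs1
        · simp
        · exact (hstrict hs hs1).le
    _ = N * Real.log N := by
        have : (L.sum : ℝ) - L.length = N - 1 := by
          have : L.sum + 1 = N + L.length := by omega
          have : (L.sum : ℝ) + 1 = N + L.length := by exact_mod_cast this
          linarith
        rw [hfactor, this]
        field_simp [sub_ne_zero.2 hN1.ne']

lemma sum_div_mul_logb {m : ℝ} (hm : 0 < m) (L : List ℕ) (hpos : ∀ r ∈ L, 1 ≤ r)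
    (hsum : (L.sum : ℝ) = m) :
    -(L.map fun r : ℕ => ((r : ℝ) / m) * Real.logb 2 ((r : ℝ) / m)).sum =
      Real.logb 2 m - (L.map fun r : ℕ => (r : ℝ) * Real.log r).sum / (m * Real.log 2) := by
  have key : ∀ K : List ℕ, (∀ r ∈ K, 1 ≤ r) →
      (K.map fun r : ℕ => ((r : ℝ) / m) * Real.logb 2 ((r : ℝ) / m)).sum =
        (K.map fun r : ℕ => (r : ℝ) * Real.log r).sum / (m * Real.log 2) -
          K.sum / m * Real.logb 2 m := by
    intro K hK
    induction K with
    | nil => simp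
    | cons r K ih =>
      have hr : (r : ℝ) ≠ 0 := by
        have := hK r (by simp)
        positivity
      simp only [List.map_cons, List.sum_cons, ih fun s hs => hK s (by simp [hs])]
      rw [Real.logb_div hr hm.ne', Real.logb, Real.logb]
      push_cast
      field_simp
      ring
  rw [key L hpos, hsum, div_self hm.ne']
  ring

/-- For `n ≥ 1`, `q ≥ 2`, `m = n+1` and `R ∈ [m]`, the minimum of `H^In_{1-Ins}` over all
channel outputs in `Σ_{q,R}^m` equals `log₂ m - ((m-R+1) log₂(m-R+1))/m`, and it is
attained exactly by the skewed channel outputs. -/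
theorem stmt_12 (q n R : ℕ) (hq : 2 ≤ q) (hn : 1 ≤ n) (hR1 : 1 ≤ R) (hRm : R ≤ n + 1) :
    IsLeast
      ((fun y : Fin (n + 1) → Fin q => Hins q n 1 y) ''
        {y | (runLengths (List.ofFn y)).length = R})
      (Real.logb 2 ((n : ℝ) + 1)
        - ((n + 1 - R + 1 : ℕ) : ℝ) * Real.logb 2 ((n + 1 - R + 1 : ℕ) : ℝ) /
            ((n : ℝ) + 1))
    ∧ ∀ y : Fin (n + 1) → Fin q, (runLengths (List.ofFn y)).length = R →
        (Hins q n 1 y =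
            Real.logb 2 ((n : ℝ) + 1)
              - ((n + 1 - R + 1 : ℕ) : ℝ) * Real.logb 2 ((n + 1 - R + 1 : ℕ) : ℝ) /
                  ((n : ℝ) + 1)
          ↔ isSkewed (n + 1) R (runLengths (List.ofFn y))) := by
  have hm : (0 : ℝ) < (n : ℝ) + 1 := by positivity
  have hlog : 0 < Real.log 2 := Real.log_pos one_lt_two
  have hcast : n + 1 - R + 1 = n + 1 - (R - 1) := by omega
  have hsum (y : Fin (n + 1) → Fin q) : (runLengths (List.ofFn y)).sum = n + 1 := by
    simp [sum_runLengths_s12]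
  have hH (y : Fin (n + 1) → Fin q) : Hins q n 1 y = Real.logb 2 ((n : ℝ) + 1) -
      ((runLengths (List.ofFn y)).map fun r : ℕ => (r : ℝ) * Real.log r).sum /
        (((n : ℝ) + 1) * Real.log 2) := by
    rw [Hins_one_eq_sum_runLengths,
      sum_div_mul_logb hm _ (one_le_of_mem_runLengths _) (by rw [hsum]; push_cast; rfl)]
  have hrhs : ((n + 1 - R + 1 : ℕ) : ℝ) * Real.logb 2 ((n + 1 - R + 1 : ℕ) : ℝ) /
      ((n : ℝ) + 1) = ((n + 1 - (R - 1) : ℕ) : ℝ) * Real.log ((n + 1 - (R - 1) : ℕ) : ℝ) /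
        (((n : ℝ) + 1) * Real.log 2) := by
    rw [hcast, Real.logb]
    field_simp
  have heq (y : Fin (n + 1) → Fin q) (hs : isSkewed (n + 1) R (runLengths (List.ofFn y))) :
      Hins q n 1 y = Real.logb 2 ((n : ℝ) + 1) - ((n + 1 - R + 1 : ℕ) : ℝ) *
        Real.logb 2 ((n + 1 - R + 1 : ℕ) : ℝ) / ((n : ℝ) + 1) := by
    rw [hH, hrhs, sum_mul_log_of_isSkewed hs]
  have hlt (y : Fin (n + 1) → Fin q) (hy : (runLengths (List.ofFn y)).length = R)
      (hs : ¬ isSkewed (n + 1) R (runLengths (List.ofFn y))) :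
      Real.logb 2 ((n : ℝ) + 1) - ((n + 1 - R + 1 : ℕ) : ℝ) *
        Real.logb 2 ((n + 1 - R + 1 : ℕ) : ℝ) / ((n : ℝ) + 1) < Hins q n 1 y := by
    rw [hH, hrhs]
    have h := sum_mul_log_lt_of_not_isSkewed (L := runLengths (List.ofFn y))
      (List.ne_nil_of_length_pos (by omega)) (one_le_of_mem_runLengths _)
      (by rwa [hsum, hy])
    rw [hsum, hy] at h
    gcongr
  refine ⟨⟨?_, ?_⟩, fun y hy => ⟨fun h => ?_, heq y⟩⟩
  · have : Nontrivial (Fin q) := Fin.nontrivial_iff_two_le.2 hq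
    obtain ⟨l, hl⟩ := exists_runLengths_eq_s12 (List.replicate (R - 1) 1) (by simp) (n + 1 - R)
      (⟨0, by omega⟩ : Fin q)
    have hlen := sum_runLengths_s12 ((⟨0, by omega⟩ : Fin q) :: l)
    rw [hl] at hlen
    generalize (⟨0, by omega⟩ : Fin q) :: l = w at hl hlen
    have hw : w.length = n + 1 := by
      simp at hlen
      omega
    obtain ⟨y, rfl⟩ : ∃ y : Fin (n + 1) → Fin q, List.ofFn y = w := by
      rw [← hw]
      exact ⟨w.get, by simp⟩
    refine ⟨y, ?_, heq y ?_⟩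
    · rw [Set.mem_ofPred_eq, hl, List.length_cons, List.length_replicate]
      omega
    · rw [hl, hcast]
      exact List.Perm.refl _
  · rintro _ ⟨y, hy, rfl⟩
    by_cases hs : isSkewed (n + 1) R (runLengths (List.ofFn y))
    · exact (heq y hs).ge
    · exact (hlt y hy hs).le
  · by_contra hs
    exact (hlt y hy hs).ne' h

end
end
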